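/- Let (Z, d) be a metric space equipped with its Borel σ-algebra, let P be a probability measure on Z, let ℓ : Z → [0, ∞) be measurable, let ε ≥ 0, and suppose there exists a measurable map T : Z → Z such that for P-almost every z: d(z, T(z)) ≤ ε and ℓ(T(z)) = sup { ℓ(z') : z' ∈ Z, d(z, z') ≤ ε }. Then there exists a probability measure P* on Z (namely P* = T#P) and a coupling M of P and P* such that ∫_{Z×Z} d(y, z) dM(y, z) ≤ ε and the adversarial risk of P equals the ordinary risk of P*: ∫_Z sup { ℓ(z') : d(z, z') ≤ ε } dP(z) = ∫_Z ℓ dP*. -/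

import Mathlib

open MeasureTheory

/-- Lemma 3.3: given a measurable worst-case perturbation map `T` with
`d(z, T z) ≤ ε` and `ℓ(T z) = sup {ℓ z' | d(z, z') ≤ ε}` `P`-a.e., there is a
probability measure `P*` (namely `T#P`) and a coupling of `P` and `P*` with
transport cost at most `ε` such that the adversarial risk of `P` equals the
ordinary risk of `P*`. -/
theorem adversarial_risk_eq_risk_on_pushforward
    {Z : Type*} [MetricSpace Z] [MeasurableSpace Z] [BorelSpace Z]
    (P : Measure Z) [IsProbabilityMeasure P]
    (ℓ : Z → ℝ) (hℓm : Measurable ℓ) (hℓ0 : ∀ z, 0 ≤ ℓ z)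
    (ε : ℝ) (hε : 0 ≤ ε)
    (T : Z → Z) (hT : Measurable T)
    (hTae : ∀ᵐ z ∂P, dist z (T z) ≤ ε ∧
      ℓ (T z) = sSup (ℓ '' {z' : Z | dist z z' ≤ ε})) :
    ∃ Pstar : Measure Z, IsProbabilityMeasure Pstar ∧ Pstar = P.map T ∧
      ∃ M : Measure (Z × Z), IsProbabilityMeasure M ∧
        M.map Prod.fst = P ∧ M.map Prod.snd = Pstar ∧
        (∫ p, dist p.1 p.2 ∂M ≤ ε) ∧
        (∫ z, sSup (ℓ '' {z' : Z | dist z z' ≤ ε}) ∂P = ∫ z, ℓ z ∂Pstar) := by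
  have hG : Measurable fun z => (z, T z) := measurable_id.prodMk hT
  refine ⟨P.map T, Measure.isProbabilityMeasure_map hT.aemeasurable, rfl,
    P.map fun z => (z, T z), Measure.isProbabilityMeasure_map hG.aemeasurable, ?_, ?_, ?_, ?_⟩
  · rw [Measure.map_map measurable_fst hG]
    exact Measure.map_id
  · rw [Measure.map_map measurable_snd hG]
    rfl
  · -- without separability, `dist` need not be measurable for the product σ-algebra
    by_cases hd : AEStronglyMeasurable (fun p : Z × Z => dist p.1 p.2) (P.map fun z => (z, T z))
    · rw [integral_map hG.aemeasurable hd]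
      calc ∫ z, dist z (T z) ∂P ≤ ∫ _, ε ∂P :=
            integral_mono_of_nonneg (.of_forall fun _ => dist_nonneg) (integrable_const ε)
              (hTae.mono fun _ hz => hz.1)
        _ = ε := by simp
    · rwa [integral_undef fun h => hd h.aestronglyMeasurable]
  · rw [integral_map hT.aemeasurable hℓm.aestronglyMeasurable]
    exact integral_congr_ae (hTae.mono fun _ hz => hz.2.symm)
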